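/- Fix τ ∈ (1/e, 1). There exist δ₀ ∈ (0, 1) and C > 0, depending only on τ, with the following property. Let σ, c : [0, ϱ(τ)] → ℝ be measurable with 0 ≤ σ(t) ≤ τ and |c(t)| ≤ 1 for all t, and let y : [-τ, ϱ(τ)] → ℝ be continuous with 0 ≤ y(t) ≤ 1 for all t ∈ [-τ, ϱ(τ)], max y > 0, y(ϱ(τ)) = 0, and y(t) = y(0) - ∫_0^t c(s)·y(s - σ(s)) ds for all t ∈ [0, ϱ(τ)]; set a(t) := x_τ(t) - y(t). If δ ∈ (0, δ₀] and a(ϱ(τ) - τ) ≤ δ, then 0 ≤ a(t) ≤ C·δ^(2^(-⌊ϱ(τ)/τ⌋)) for all t ∈ [0, ϱ(τ) - τ], where ⌊·⌋ is the greatest integer function. -/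

import Mathlib

open Real MeasureTheory Filter Set

noncomputable section

/-- `x` is the solution of `x'(t) = -x(t-τ)` with `x ≡ 1` on `(-∞,0]`:
`x(t) = 1 - ∫_0^t x(s-τ) ds` for `t ≥ 0`. -/
def IsXSol (τ : ℝ) (x : ℝ → ℝ) : Prop :=
  Continuous x ∧ (∀ t ≤ (0:ℝ), x t = 1) ∧
    ∀ t ≥ (0:ℝ), x t = 1 - ∫ s in (0:ℝ)..t, x (s - τ)

/-- The first positive root of a function. -/
noncomputable def firstRoot (x : ℝ → ℝ) : ℝ := sInf {t : ℝ | 0 < t ∧ x t = 0}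

/-- `ψ` is the solution of `ψ'(t) = max{x_τ(ϱ(τ)+t-τ), ψ(t)}` on `[0,τ]`,
`ψ'(t) = ψ(t)` on `[τ,∞)`, `ψ(0) = 0`. -/
def IsPsiSol (τ ρ : ℝ) (xτ ψ : ℝ → ℝ) : Prop :=
  ContinuousOn ψ (Ici (0:ℝ)) ∧ ψ 0 = 0 ∧
    (∀ t ∈ Icc (0:ℝ) τ, ψ t = ∫ s in (0:ℝ)..t, max (xτ (ρ + s - τ)) (ψ s)) ∧
    (∀ t ≥ τ, ψ t = ψ τ + ∫ s in τ..t, ψ s)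

/-- A (continuous, integrated-form) solution of the delay equation
`x'(t) = p(t) x(τ̄(t))` on `[t₀,∞)`. -/
def IsDelaySolution (p τd : ℝ → ℝ) (t₀ : ℝ) (x : ℝ → ℝ) : Prop :=
  Continuous x ∧ ∀ t ≥ t₀, x t = x t₀ + ∫ s in t₀..t, p s * x (τd s)

/-- `x` is `α`-oscillating: eventually every interval on which `x` has no zero
has length at most `α`. -/
def AlphaOscillating (α : ℝ) (x : ℝ → ℝ) : Prop :=
  ∃ T : ℝ, ∀ a b : ℝ, T ≤ a → a < b → (∀ t ∈ Ioo a b, x t ≠ 0) → b - a ≤ α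

/-- `x` is oscillatory: it has arbitrarily large zeros. -/
def Oscillatory (x : ℝ → ℝ) : Prop := ∀ T : ℝ, ∃ t ≥ T, x t = 0

/-- `x` solves `x'(t) = -x(t-τ)` with unit initial data and is positive before `ρ`. -/
structure IsPosBefore (τ ρ : ℝ) (x : ℝ → ℝ) : Prop where
  delay_pos : 0 < τ
  delay_le : τ ≤ ρ
  sol : IsXSol τ x
  pos : ∀ t < ρ, 0 < x t

/-- `y` takes values in `[0,1]` on `[-τ,ρ]` and satisfies `y' = -g` on `[0,ρ]`, where `|g(u)|` is
bounded by some value of `y` on `[u-τ,u]`; moreover `y(ρ) = 0`. -/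
structure IsDelayBounded (τ ρ : ℝ) (y g : ℝ → ℝ) : Prop where
  cont : ContinuousOn y (Icc (-τ) ρ)
  nonneg : ∀ t ∈ Icc (-τ) ρ, 0 ≤ y t
  le_one : ∀ t ∈ Icc (-τ) ρ, y t ≤ 1
  zero : y ρ = 0
  integrable : IntervalIntegrable g volume 0 ρ
  sub_eq : ∀ t ∈ Icc 0 ρ, y t = y 0 - ∫ u in (0:ℝ)..t, g u
  abs_le : ∀ u ∈ Icc 0 ρ, ∃ v ∈ Icc (u - τ) u, |g u| ≤ y v

theorem firstRoot_pos_before {τ : ℝ} {x : ℝ → ℝ} (hx : IsXSol τ x) {t : ℝ}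
    (ht : t < firstRoot x) : 0 < x t := by
  obtain ⟨hc, h1, -⟩ := hx
  rcases le_or_gt t 0 with h | h
  · rw [h1 t h]; exact one_pos
  by_contra! hneg
  obtain ⟨s, hs, hs0⟩ := intermediate_value_Icc' h.le hc.continuousOn
    (show (0:ℝ) ∈ Icc (x t) (x 0) from ⟨hneg, by rw [h1 0 le_rfl]; exact zero_le_one⟩)
  have hs' : 0 < s := by
    rcases hs.1.lt_or_eq with h' | h'
    · exact h'
    · rw [← h', h1 0 le_rfl] at hs0; exact absurd hs0 one_ne_zero
  have : firstRoot x ≤ s := csInf_le ⟨0, fun r hr => hr.1.le⟩ ⟨hs', hs0⟩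
  linarith [hs.2]

theorem const_mul_le_integral {f : ℝ → ℝ} {s t m : ℝ} (hst : s ≤ t)
    (hf : IntervalIntegrable f volume s t) (hm : ∀ u ∈ Icc s t, m ≤ f u) :
    m * (t - s) ≤ ∫ u in s..t, f u := by
  have := intervalIntegral.integral_mono_on hst
    (intervalIntegrable_const (c := m) (μ := volume)) hf hm
  simpa [mul_comm] using this

theorem integral_le_const_mul {f : ℝ → ℝ} {s t m : ℝ} (hst : s ≤ t)
    (hf : IntervalIntegrable f volume s t) (hm : ∀ u ∈ Icc s t, f u ≤ m) :
    ∫ u in s..t, f u ≤ m * (t - s) := by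
  have := intervalIntegral.integral_mono_on hst hf
    (intervalIntegrable_const (c := m) (μ := volume)) hm
  simpa [mul_comm] using this

theorem IsXSol.sub_eq_integral {τ : ℝ} {x : ℝ → ℝ} (hx : IsXSol τ x) {s t : ℝ} (hs : 0 ≤ s)
    (ht : 0 ≤ t) : x s - x t = ∫ u in s..t, x (u - τ) := by
  obtain ⟨hc, -, h⟩ := hx
  have hi : ∀ a b : ℝ, IntervalIntegrable (fun u => x (u - τ)) volume a b := fun a b =>
    (hc.comp (continuous_id.sub continuous_const)).intervalIntegrable a b
  rw [h s hs, h t ht, ← intervalIntegral.integral_interval_sub_left (hi 0 t) (hi 0 s)]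
  ring

namespace IsDelayBounded

variable {τ ρ : ℝ} {y g : ℝ → ℝ}

theorem intervalIntegrable (hy : IsDelayBounded τ ρ y g) {s t : ℝ} (hs : 0 ≤ s)
    (hst : s ≤ t) (ht : t ≤ ρ) : IntervalIntegrable g volume s t := by
  refine hy.integrable.mono_set ?_
  rw [uIcc_of_le hst, uIcc_of_le (hs.trans (hst.trans ht))]
  exact Icc_subset_Icc hs ht

theorem sub_eq_integral (hy : IsDelayBounded τ ρ y g) {s t : ℝ} (hs : 0 ≤ s)
    (hst : s ≤ t) (ht : t ≤ ρ) : y s - y t = ∫ u in s..t, g u := by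
  have h1 := hy.intervalIntegrable le_rfl hs (hst.trans ht)
  have h2 := hy.intervalIntegrable le_rfl (hs.trans hst) ht
  rw [hy.sub_eq s ⟨hs, hst.trans ht⟩, hy.sub_eq t ⟨hs.trans hst, ht⟩,
    ← intervalIntegral.integral_interval_sub_left h2 h1]
  ring

end IsDelayBounded

namespace IsPosBefore

variable {τ ρ : ℝ} {x : ℝ → ℝ}

theorem intervalIntegrable (hx : IsPosBefore τ ρ x) (s t : ℝ) :
    IntervalIntegrable (fun u => x (u - τ)) volume s t :=
  (hx.sol.1.comp (continuous_id.sub continuous_const)).intervalIntegrable s t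

theorem le_of_le (hx : IsPosBefore τ ρ x) {s t : ℝ} (hst : s ≤ t) (ht : t ≤ ρ) : x t ≤ x s := by
  have key : ∀ s t : ℝ, 0 ≤ s → s ≤ t → t ≤ ρ → x t ≤ x s := by
    intro s t hs hst ht
    have h := const_mul_le_integral (m := 0) hst (hx.intervalIntegrable s t) fun u hu =>
      (hx.pos (u - τ) (by linarith [hu.2, hx.delay_pos])).le
    rw [← hx.sol.sub_eq_integral hs (hs.trans hst)] at h
    linarith
  rcases le_total 0 s with hs | hs
  · exact key s t hs hst ht
  rw [hx.sol.2.1 s hs, ← hx.sol.2.1 0 le_rfl]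
  rcases le_total 0 t with h | h
  · exact key 0 t le_rfl h ht
  · rw [hx.sol.2.1 t h, hx.sol.2.1 0 le_rfl]

theorem le_one (hx : IsPosBefore τ ρ x) {t : ℝ} (ht : t ≤ ρ) : x t ≤ 1 := by
  have := hx.le_of_le (min_le_left t 0) ht
  rwa [hx.sol.2.1 _ (min_le_right t 0)] at this

theorem slope_le (hx : IsPosBefore τ ρ x) {s t : ℝ} (hs : 0 ≤ s) (hst : s ≤ t) (ht : t ≤ ρ) :
    x (ρ - τ) * (t - s) ≤ x s - x t := by
  rw [hx.sol.sub_eq_integral hs (hs.trans hst)]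
  exact const_mul_le_integral hst (hx.intervalIntegrable s t) fun u hu =>
    hx.le_of_le (by linarith [hu.2]) (by linarith [hx.delay_pos])

variable {y g : ℝ → ℝ}

/-- Comparison principle: `y` stays below `x`. Among all shifts `m` for which the graph of
`x(· - m)` is met by `y`, the largest one would keep `y` positive up to `ρ`. -/
theorem delayBounded_le (hx : IsPosBefore τ ρ x) (hy : IsDelayBounded τ ρ y g) {t : ℝ}
    (ht : t ∈ Icc (-τ) ρ) : y t ≤ x t := by
  have hτ := hx.delay_pos
  have hτρ := hx.delay_le
  have hxc := hx.sol.1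
  have larger : ∀ t ∈ Icc (-τ) ρ, ∀ m, 0 ≤ m → x (t - m) < y t →
      ∃ m', m < m' ∧ m' ≤ t ∧ x (t - m') ≤ y t := by
    intro t ht m hm hlt
    have hmt : m < t := by
      by_contra! h
      rw [hx.sol.2.1 (t - m) (by linarith)] at hlt
      exact absurd (hy.le_one t ht) (not_le.2 hlt)
    have hcont : ContinuousOn (fun m => x (t - m)) (Icc m t) :=
      (hxc.comp (continuous_const.sub continuous_id)).continuousOn
    obtain ⟨m', hm', he⟩ := intermediate_value_Icc hmt.le hcont
      (show y t ∈ Icc (x (t - m)) (x (t - t)) from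
        ⟨hlt.le, by rw [hx.sol.2.1 (t - t) (by linarith)]; exact hy.le_one t ht⟩)
    have he : x (t - m') = y t := he
    refine ⟨m', lt_of_le_of_ne hm'.1 ?_, hm'.2, he.le⟩
    rintro rfl
    exact hlt.ne he
  by_contra! hlt
  obtain ⟨m₁, hm₁, hm₁t, hm₁y⟩ := larger t ht 0 le_rfl (by simpa using hlt)
  let B : Set (ℝ × ℝ) := Icc (-τ) ρ ×ˢ Icc 0 ρ
  have hBc : IsCompact B := isCompact_Icc.prod isCompact_Icc
  let K : Set (ℝ × ℝ) := B ∩ (fun p : ℝ × ℝ => (y p.1 - x (p.1 - p.2), p.1 - p.2)) ⁻¹'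
    (Ici 0 ×ˢ Ici 0)
  have hK : IsCompact K := by
    refine hBc.of_isClosed_subset ?_ inter_subset_left
    refine ContinuousOn.preimage_isClosed_of_isClosed ?_ hBc.isClosed
      (isClosed_Ici.prod isClosed_Ici)
    refine ContinuousOn.prodMk (ContinuousOn.sub ?_ ?_) (by fun_prop)
    · exact hy.cont.comp continuous_fst.continuousOn fun p hp => hp.1
    · exact (hxc.comp (continuous_fst.sub continuous_snd)).continuousOn
  have memK : ∀ t ∈ Icc (-τ) ρ, ∀ m, 0 ≤ m → m ≤ t → x (t - m) ≤ y t → (t, m) ∈ K :=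
    fun t ht m hm hmt h =>
      ⟨⟨ht, hm, hmt.trans ht.2⟩, by simpa using h, by simpa using hmt⟩
  obtain ⟨⟨t₀, M⟩, hmem, hmax⟩ := hK.exists_isMaxOn
    ⟨_, memK t ht m₁ hm₁.le hm₁t hm₁y⟩ continuous_snd.continuousOn
  have hM : 0 < M := hm₁.trans_le (hmax (memK t ht m₁ hm₁.le hm₁t hm₁y))
  obtain ⟨⟨ht₀, -⟩, hy₀, hMt⟩ := hmem
  simp only [mem_Ici, sub_nonneg] at hy₀ hMt
  have hle : ∀ s ∈ Icc (-τ) ρ, y s ≤ x (s - M) := by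
    intro s hs
    by_contra! h
    obtain ⟨m', h1, h2, h3⟩ := larger s hs M hM.le h
    exact absurd (hmax (memK s hs m' (hM.le.trans h1.le) h2 h3)) (not_le.2 h1)
  have ht₀' : t₀ ≤ ρ := ht₀.2
  have hint : IntervalIntegrable (fun u => x (u - M - τ)) volume t₀ ρ :=
    (hxc.comp ((continuous_id.sub continuous_const).sub continuous_const)).intervalIntegrable _ _
  have hmono : ∫ u in t₀..ρ, g u ≤ ∫ u in t₀..ρ, x (u - M - τ) := by
    refine intervalIntegral.integral_mono_on ht₀'
      (hy.intervalIntegrable (by linarith) ht₀' le_rfl) hint fun u hu => ?_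
    obtain ⟨v, hv, hgv⟩ := hy.abs_le u ⟨by linarith [hu.1], hu.2⟩
    calc g u ≤ y v := (le_abs_self _).trans hgv
      _ ≤ x (v - M) := hle v ⟨by linarith [hu.1, hv.1], hv.2.trans hu.2⟩
      _ ≤ x (u - M - τ) := hx.le_of_le (by linarith [hv.1]) (by linarith [hv.2, hu.2])
  rw [← hy.sub_eq_integral (by linarith) ht₀' le_rfl,
    intervalIntegral.integral_comp_sub_right (fun u => x (u - τ)) M,
    ← hx.sol.sub_eq_integral (by linarith) (by linarith), hy.zero] at hmono
  linarith [hx.pos (ρ - M) (by linarith)]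

theorem gap_sub_eq (hx : IsPosBefore τ ρ x) (hy : IsDelayBounded τ ρ y g) {s t : ℝ} (hs : 0 ≤ s)
    (hst : s ≤ t) (ht : t ≤ ρ) :
    (x s - y s) - (x t - y t) = ∫ u in s..t, (x (u - τ) - g u) := by
  rw [intervalIntegral.integral_sub (hx.intervalIntegrable s t) (hy.intervalIntegrable hs hst ht),
    ← hx.sol.sub_eq_integral hs (hs.trans hst), ← hy.sub_eq_integral hs hst ht]
  ring

theorem mul_le_gap_sub (hx : IsPosBefore τ ρ x) (hy : IsDelayBounded τ ρ y g) {s t m : ℝ}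
    (hs : 0 ≤ s) (hst : s ≤ t) (ht : t ≤ ρ) (hm : ∀ u ∈ Icc s t, m ≤ x (u - τ) - g u) :
    m * (t - s) ≤ (x s - y s) - (x t - y t) := by
  rw [hx.gap_sub_eq hy hs hst ht]
  exact const_mul_le_integral hst
    ((hx.intervalIntegrable s t).sub (hy.intervalIntegrable hs hst ht)) hm

theorem gap_antitone (hx : IsPosBefore τ ρ x) (hy : IsDelayBounded τ ρ y g) {s t : ℝ}
    (hs : 0 ≤ s) (hst : s ≤ t) (ht : t ≤ ρ) : x t - y t ≤ x s - y s := by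
  have h := hx.mul_le_gap_sub hy (m := 0) hs hst ht fun u hu => by
    obtain ⟨v, hv, hgv⟩ := hy.abs_le u ⟨hs.trans hu.1, hu.2.trans ht⟩
    have h1 := hx.delayBounded_le hy (t := v)
      ⟨by linarith [hv.1, hu.1], by linarith [hv.2, hu.2]⟩
    have h2 := hx.le_of_le hv.1 (by linarith [hv.2, hu.2])
    linarith [le_abs_self (g u)]
  linarith

theorem gap_sub_le (hx : IsPosBefore τ ρ x) (hy : IsDelayBounded τ ρ y g) {s t : ℝ}
    (hs : 0 ≤ s) (hst : s ≤ t) (ht : t ≤ ρ) :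
    (x s - y s) - (x t - y t) ≤ 2 * (t - s) := by
  rw [hx.gap_sub_eq hy hs hst ht]
  refine integral_le_const_mul hst
    ((hx.intervalIntegrable s t).sub (hy.intervalIntegrable hs hst ht)) fun u hu => ?_
  obtain ⟨v, hv, hgv⟩ := hy.abs_le u ⟨hs.trans hu.1, hu.2.trans ht⟩
  have h1 := hy.le_one v ⟨by linarith [hv.1, hu.1], by linarith [hv.2, hu.2]⟩
  have h2 := hx.le_one (t := u - τ) (by linarith [hu.2, hx.delay_pos])
  linarith [neg_abs_le (g u)]

/-- The decay rate of the gap at `u` controls the gap at `u - τ`. -/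
theorem mul_gap_le (hx : IsPosBefore τ ρ x) (hy : IsDelayBounded τ ρ y g) {u : ℝ}
    (hu : u ∈ Icc τ ρ) :
    x (ρ - τ) / 2 * (x (u - τ) - y (u - τ)) ≤ x (u - τ) - g u := by
  have hτ := hx.delay_pos
  obtain ⟨v, hv, hgv⟩ := hy.abs_le u ⟨by linarith [hu.1], hu.2⟩
  have hvρ : v ≤ ρ := hv.2.trans hu.2
  have h0 : 0 ≤ u - τ := by linarith [hu.1]
  have h1 := hx.slope_le h0 hv.1 hvρ
  have h2 := hx.gap_sub_le hy h0 hv.1 hvρ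
  have h3 := hx.delayBounded_le hy (t := v) ⟨by linarith [hv.1], hvρ⟩
  have hκ := hx.pos (ρ - τ) (by linarith)
  have hκ1 := hx.le_one (t := ρ - τ) (by linarith)
  nlinarith [le_abs_self (g u), mul_le_mul_of_nonneg_left h2 hκ.le,
    mul_nonneg (sub_nonneg.2 hκ1) (sub_nonneg.2 h3)]

/-- A bound `r²` for the gap at `T` propagates to a bound of order `r` one delay earlier. -/
theorem gap_le_of_gap_le_sq (hx : IsPosBefore τ ρ x) (hy : IsDelayBounded τ ρ y g) {S T r : ℝ}
    (hS : 0 ≤ S) (hST : S ≤ T) (hTS : T ≤ S + τ) (hT : T + τ ≤ ρ) (hr : 0 < r)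
    (h : x T - y T ≤ r ^ 2) : x S - y S ≤ (2 / x (ρ - τ) + 3) * r := by
  have hτ := hx.delay_pos
  have hκ := hx.pos (ρ - τ) (by linarith)
  have hκr : 0 < 2 / x (ρ - τ) * r := by positivity
  rcases le_total 1 r with h1 | h1
  · have := hx.le_one (t := S) (by linarith)
    have := hy.nonneg S ⟨by linarith, by linarith⟩
    nlinarith
  rcases le_total T (S + r) with hr' | hr'
  · have := hx.gap_sub_le hy hS hST (by linarith)
    nlinarith
  have h2 := hx.gap_sub_le hy hS (t := S + r) (by linarith) (by linarith)
  have h3 := hx.gap_antitone hy (by linarith) hTS (by linarith)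
  have h4 := hx.delayBounded_le hy (t := S + r + τ) ⟨by linarith, by linarith⟩
  have h5 := hx.mul_le_gap_sub hy (s := S + τ) (t := S + r + τ)
    (m := x (ρ - τ) / 2 * (x (S + r) - y (S + r))) (by linarith) (by linarith) (by linarith)
    fun u hu => le_trans
      (mul_le_mul_of_nonneg_left
        (hx.gap_antitone hy (by linarith [hu.1]) (by linarith [hu.2]) (by linarith)) (by positivity))
      (hx.mul_gap_le hy ⟨by linarith [hu.1], by linarith [hu.2]⟩)
  have h6 : x (ρ - τ) / 2 * (x (S + r) - y (S + r)) ≤ r := by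
    refine le_of_mul_le_mul_right ?_ hr
    nlinarith
  have h7 : x (S + r) - y (S + r) ≤ 2 / x (ρ - τ) * r := by
    rw [div_mul_eq_mul_div, le_div_iff₀ hκ]
    linarith
  linarith

theorem gap_le_rpow (hx : IsPosBefore τ ρ x) (hy : IsDelayBounded τ ρ y g) {δ : ℝ} (hδ : 0 < δ)
    (h : x (ρ - τ) - y (ρ - τ) ≤ δ) (j : ℕ) :
    x (max (ρ - (j + 1) * τ) 0) - y (max (ρ - (j + 1) * τ) 0) ≤
      (2 / x (ρ - τ) + 3) ^ 2 * δ ^ ((2:ℝ) ^ (-(j : ℤ))) := by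
  have hτ := hx.delay_pos
  have hτρ := hx.delay_le
  have hκ := hx.pos (ρ - τ) (by linarith)
  have hK : 3 ≤ 2 / x (ρ - τ) + 3 := by
    have : 0 < 2 / x (ρ - τ) := by positivity
    linarith
  set K := 2 / x (ρ - τ) + 3
  induction j with
  | zero =>
    rw [max_eq_left (by push_cast; linarith)]
    simp only [Nat.cast_zero, zero_add, one_mul, neg_zero, zpow_zero, rpow_one]
    exact h.trans (le_mul_of_one_le_left hδ.le (one_le_pow₀ (by linarith)))
  | succ j ih =>
    set r := K * δ ^ ((2:ℝ) ^ (-((j + 1 : ℕ) : ℤ))) with hrdef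
    have hr : 0 < r := by positivity
    have hsq : K ^ 2 * δ ^ ((2:ℝ) ^ (-(j : ℤ))) = r ^ 2 := by
      rw [hrdef, mul_pow, ← rpow_natCast (δ ^ _) 2, ← rpow_mul hδ.le]
      congr 2
      rw [Nat.cast_succ, neg_add, zpow_add₀ two_ne_zero]
      norm_num
      ring
    rw [hsq] at ih
    have hle : ρ - ((j + 1 : ℕ) + 1) * τ = ρ - (j + 1) * τ - τ := by push_cast; ring
    have := hx.gap_le_of_gap_le_sq hy (S := max (ρ - ((j + 1 : ℕ) + 1) * τ) 0) (le_max_right _ _)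
      (max_le_max (by linarith) le_rfl)
      (max_le (by linarith [le_max_left (ρ - ((j + 1 : ℕ) + 1) * τ) 0])
        (by linarith [le_max_right (ρ - ((j + 1 : ℕ) + 1) * τ) 0]))
      (by
        have : (0:ℝ) ≤ j * τ := by positivity
        have : max (ρ - (j + 1) * τ) 0 ≤ ρ - τ := max_le (by linarith) (by linarith)
        linarith) hr ih
    rw [hrdef] at this
    linarith

end IsPosBefore

theorem isDelayBounded_of_delay {τ ρ : ℝ} (hτ : 0 < τ) (hτρ : τ ≤ ρ) {σ c y : ℝ → ℝ}
    (hσ : Measurable σ) (hc : Measurable c)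
    (hσb : ∀ t ∈ Icc (0:ℝ) ρ, 0 ≤ σ t ∧ σ t ≤ τ) (hcb : ∀ t ∈ Icc (0:ℝ) ρ, |c t| ≤ 1)
    (hy : ContinuousOn y (Icc (-τ) ρ)) (hyb : ∀ t ∈ Icc (-τ) ρ, 0 ≤ y t ∧ y t ≤ 1)
    (hy0 : y ρ = 0)
    (heq : ∀ t ∈ Icc (0:ℝ) ρ, y t = y 0 - ∫ s in (0:ℝ)..t, c s * y (s - σ s)) :
    IsDelayBounded τ ρ y fun s => c s * y (s - σ s) := by
  have hmem : ∀ u ∈ Icc (0:ℝ) ρ, u - σ u ∈ Icc (-τ) ρ := fun u hu =>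
    ⟨by linarith [hu.1, (hσb u hu).2], by linarith [hu.2, (hσb u hu).1]⟩
  have habs : ∀ u ∈ Icc (0:ℝ) ρ, |c u * y (u - σ u)| ≤ y (u - σ u) := fun u hu => by
    rw [abs_mul, abs_of_nonneg (hyb _ (hmem u hu)).1]
    exact mul_le_of_le_one_left (hyb _ (hmem u hu)).1 (hcb u hu)
  refine ⟨hy, fun t ht => (hyb t ht).1, fun t ht => (hyb t ht).2, hy0, ?_, heq, fun u hu =>
    ⟨u - σ u, ⟨by linarith [(hσb u hu).2], by linarith [(hσb u hu).1]⟩, habs u hu⟩⟩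
  have hle : -τ ≤ ρ := by linarith
  have hY : Continuous (IccExtend hle ((Icc (-τ) ρ).domRestrict y)) :=
    continuous_IccExtend_iff.2 hy.domRestrict
  have hmeas : Measurable fun s => c s * IccExtend hle ((Icc (-τ) ρ).domRestrict y) (s - σ s) :=
    hc.mul (hY.measurable.comp (measurable_id.sub hσ))
  have hYeq : ∀ u ∈ Icc (0:ℝ) ρ,
      c u * IccExtend hle ((Icc (-τ) ρ).domRestrict y) (u - σ u) = c u * y (u - σ u) := fun u hu => by
    rw [IccExtend_of_mem hle _ (hmem u hu), domRestrict_apply]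
  rw [intervalIntegrable_iff_integrableOn_Icc_of_le (by linarith)]
  refine IntegrableOn.congr_fun (f := fun s =>
    c s * IccExtend hle ((Icc (-τ) ρ).domRestrict y) (s - σ s)) ?_ hYeq measurableSet_Icc
  refine Measure.integrableOn_of_bounded (M := 1) measure_Icc_lt_top.ne
    hmeas.aestronglyMeasurable ?_
  filter_upwards [ae_restrict_mem measurableSet_Icc] with u hu
  rw [hYeq u hu, norm_eq_abs]
  exact (habs u hu).trans (hyb _ (hmem u hu)).2

theorem stmt3 (τ : ℝ) (hτ1 : 1 / Real.exp 1 < τ) (hτ2 : τ < 1)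
    (xτ : ℝ → ℝ) (hx : IsXSol τ xτ) (ρ : ℝ) (hρ : ρ = firstRoot xτ) :
    ∃ δ₀ ∈ Ioo (0:ℝ) 1, ∃ C > (0:ℝ),
      ∀ (σ c y : ℝ → ℝ) (δ : ℝ),
        Measurable σ → Measurable c →
        (∀ t ∈ Icc (0:ℝ) ρ, 0 ≤ σ t ∧ σ t ≤ τ) →
        (∀ t ∈ Icc (0:ℝ) ρ, |c t| ≤ 1) →
        ContinuousOn y (Icc (-τ) ρ) →
        (∀ t ∈ Icc (-τ) ρ, 0 ≤ y t ∧ y t ≤ 1) →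
        (∃ t ∈ Icc (-τ) ρ, 0 < y t) →
        y ρ = 0 →
        (∀ t ∈ Icc (0:ℝ) ρ, y t = y 0 - ∫ s in (0:ℝ)..t, c s * y (s - σ s)) →
        δ ∈ Ioc (0:ℝ) δ₀ →
        xτ (ρ - τ) - y (ρ - τ) ≤ δ →
        ∀ t ∈ Icc (0:ℝ) (ρ - τ),
          0 ≤ xτ t - y t ∧
          xτ t - y t ≤ C * δ ^ ((2:ℝ) ^ (-(⌊ρ / τ⌋ : ℤ))) := by
  have hτ : 0 < τ := lt_trans (by positivity) hτ1
  rcases lt_or_ge ρ τ with hlt | hτρ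
  · refine ⟨1 / 2, by norm_num, 1, one_pos, ?_⟩
    intro _ _ _ _ _ _ _ _ _ _ _ _ _ _ _ t ht
    linarith [ht.1, ht.2]
  have hxp : IsPosBefore τ ρ xτ :=
    ⟨hτ, hτρ, hx, fun t ht => firstRoot_pos_before hx (hρ ▸ ht)⟩
  have hκ := hxp.pos (ρ - τ) (by linarith)
  refine ⟨1 / 2, by norm_num, (2 / xτ (ρ - τ) + 3) ^ 2, by positivity, ?_⟩
  intro σ c y δ hσ hc hσb hcb hy hyb _ hy0 heq hδ hδa t ht
  have hyp := isDelayBounded_of_delay hτ hτρ hσ hc hσb hcb hy hyb hy0 heq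
  refine ⟨sub_nonneg.2 (hxp.delayBounded_le hyp ⟨by linarith [ht.1], by linarith [ht.2]⟩),
    (hxp.gap_antitone hyp le_rfl ht.1 (by linarith [ht.2])).trans ?_⟩
  have hfloor : (0:ℤ) ≤ ⌊ρ / τ⌋ := Int.floor_nonneg.2 (div_nonneg (hτ.le.trans hτρ) hτ.le)
  obtain ⟨n, hn⟩ := Int.eq_ofNat_of_zero_le hfloor
  have hlt : ρ / τ < n + 1 := by
    have := Int.lt_floor_add_one (ρ / τ)
    rwa [hn, Int.cast_natCast] at this
  have h := hxp.gap_le_rpow hyp hδ.1 hδa n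
  rw [div_lt_iff₀ hτ] at hlt
  rwa [max_eq_right (by linarith), ← hn] at h
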